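/- arXiv:2312.05936 — 3 statements merged into one kernel-verified Lean document; each statement's English description precedes it below -/
import Mathlib

section
/- For all positive integers k, n, and s, the sum of the Cohen–Ramanujan sums evaluated at n^s over the divisors of k satisfies ∑_{q | k} c_q^{(s)}(n^s) = k^s if k | n, and ∑_{q | k} c_q^{(s)}(n^s) = 0 if k ∤ n. -/
open scoped BigOperators

/-- The generalized GCD `(a,b)_s`: the largest positive integer of the form `d^s`
dividing both `a` and `b`. -/
noncomputable def ggcd (s a b : ℕ) : ℕ :=
  sSup {m : ℕ | (∃ d : ℕ, m = d ^ s) ∧ m ∣ a ∧ m ∣ b}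

/-- The Cohen–Ramanujan sum `c_q^{(s)}(n) = ∑_{h=1, (h,q^s)_s=1}^{q^s} e^{2πinh/q^s}`. -/
noncomputable def cohenRamanujan (s q n : ℕ) : ℂ :=
  ∑ h ∈ Finset.Icc 1 (q ^ s),
    if ggcd s h (q ^ s) = 1 then
      Complex.exp (2 * Real.pi * Complex.I * n * h / (q ^ s)) else 0

theorem ggcd_pow_eq_one_iff {s q : ℕ} (hs : 0 < s) (hq : 0 < q) (h : ℕ) :
    ggcd s h (q ^ s) = 1 ↔ ∀ d : ℕ, d ^ s ∣ h → d ∣ q → d = 1 := by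
  have hqs : 0 < q ^ s := by positivity
  have hbdd : BddAbove {m : ℕ | (∃ d : ℕ, m = d ^ s) ∧ m ∣ h ∧ m ∣ q ^ s} :=
    ⟨q ^ s, fun m hm => Nat.le_of_dvd hqs hm.2.2⟩
  have hone : 1 ∈ {m : ℕ | (∃ d : ℕ, m = d ^ s) ∧ m ∣ h ∧ m ∣ q ^ s} :=
    ⟨⟨1, (one_pow s).symm⟩, one_dvd _, one_dvd _⟩
  constructor
  · intro hg d hdh hdq
    have hle : d ^ s ≤ 1 := hg ▸ le_csSup hbdd ⟨⟨d, rfl⟩, hdh, pow_dvd_pow_of_dvd hdq s⟩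
    have hd : 0 < d := Nat.pos_of_dvd_of_pos hdq hq
    have hd' : d ≤ d ^ s := Nat.le_self_pow hs.ne' d
    omega
  · intro H
    refine le_antisymm (csSup_le ⟨1, hone⟩ ?_) (le_csSup hbdd hone)
    rintro m ⟨⟨d, rfl⟩, hdh, hdq⟩
    rw [H d hdh ((Nat.pow_dvd_pow_iff hs.ne').1 hdq), one_pow]

/-- If `d₁ ^ s` is the largest `s`-th power of a divisor of `k = d₁ * q₁` dividing `h₁ * d₁ ^ s`,
then every divisor `d₂` of `k` whose `s`-th power divides `h₁ * d₁ ^ s` divides `d₁`. -/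
theorem dvd_of_pow_dvd_mul_pow {s k d₁ q₁ h₁ d₂ : ℕ} (hk : 0 < k) (hd₁ : d₁ * q₁ = k)
    (h : ∀ d : ℕ, d ^ s ∣ h₁ → d ∣ q₁ → d = 1) (hd₂ : d₂ ∣ k) (hdvd : d₂ ^ s ∣ h₁ * d₁ ^ s) :
    d₂ ∣ d₁ := by
  have hd₁0 : 0 < d₁ := Nat.pos_of_dvd_of_pos ⟨q₁, hd₁.symm⟩ hk
  obtain ⟨m, hm⟩ := Nat.dvd_lcm_left d₁ d₂
  have hmq : m ∣ q₁ := by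
    refine Nat.dvd_of_mul_dvd_mul_left hd₁0 ?_
    rw [← hm, hd₁]
    exact Nat.lcm_dvd ⟨q₁, hd₁.symm⟩ hd₂
  have hmh : m ^ s ∣ h₁ := by
    refine Nat.dvd_of_mul_dvd_mul_right (pow_pos hd₁0 s) ?_
    rw [← mul_pow, mul_comm m, ← hm, ← Nat.pow_lcm_pow]
    exact Nat.lcm_dvd (dvd_mul_left _ _) hdvd
  have := Nat.dvd_lcm_right d₁ d₂
  rwa [hm, h m hmh hmq, mul_one] at this

/-- Summing a function of `h / q ^ s` over the divisors `q` of `k` and the `h ≤ q ^ s` with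
`(h, q ^ s)_s = 1` amounts to summing over all fractions with denominator `k ^ s`. -/
theorem sum_divisors_sum_ggcd_eq_one {M : Type*} [AddCommMonoid M] {k s : ℕ} (hk : 0 < k)
    (hs : 0 < s) (f : ℚ → M) :
    ∑ q ∈ k.divisors, ∑ h ∈ Finset.Icc 1 (q ^ s),
        (if ggcd s h (q ^ s) = 1 then f (h / q ^ s) else 0) =
      ∑ h ∈ Finset.Icc 1 (k ^ s), f (h / k ^ s) := by
  simp_rw [← Finset.sum_filter]
  rw [Finset.sum_sigma']
  refine Finset.sum_bij (fun x _ => x.2 * (k / x.1) ^ s) ?_ ?_ ?_ ?_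
  · rintro ⟨q, h⟩ hx
    simp only [Finset.mem_sigma, Nat.mem_divisors, Finset.mem_filter, Finset.mem_Icc] at hx ⊢
    obtain ⟨⟨hqk, -⟩, ⟨h1, h2⟩, -⟩ := hx
    have hd : 0 < k / q := Nat.div_pos (Nat.le_of_dvd hk hqk) (Nat.pos_of_dvd_of_pos hqk hk)
    refine ⟨Nat.mul_pos h1 (pow_pos hd s), ?_⟩
    calc h * (k / q) ^ s ≤ q ^ s * (k / q) ^ s := Nat.mul_le_mul_right _ h2
      _ = k ^ s := by rw [← mul_pow, Nat.mul_div_cancel' hqk]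
  · rintro ⟨q₁, h₁⟩ hx ⟨q₂, h₂⟩ hy hxy
    simp only [Finset.mem_sigma, Nat.mem_divisors, Finset.mem_filter, Finset.mem_Icc] at hx hy hxy
    obtain ⟨⟨hqk₁, -⟩, -, hg₁⟩ := hx
    obtain ⟨⟨hqk₂, -⟩, -, hg₂⟩ := hy
    rw [ggcd_pow_eq_one_iff hs (Nat.pos_of_dvd_of_pos hqk₁ hk)] at hg₁
    rw [ggcd_pow_eq_one_iff hs (Nat.pos_of_dvd_of_pos hqk₂ hk)] at hg₂
    have hd : k / q₁ = k / q₂ := Nat.dvd_antisymm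
      (dvd_of_pow_dvd_mul_pow hk (Nat.div_mul_cancel hqk₂) hg₂ (Nat.div_dvd_of_dvd hqk₁)
        (hxy ▸ dvd_mul_left _ _))
      (dvd_of_pow_dvd_mul_pow hk (Nat.div_mul_cancel hqk₁) hg₁ (Nat.div_dvd_of_dvd hqk₂)
        (hxy ▸ dvd_mul_left _ _))
    have hq : q₁ = q₂ := by
      rw [← Nat.div_div_self hqk₁ hk.ne', hd, Nat.div_div_self hqk₂ hk.ne']
    subst hq
    have hd0 : 0 < k / q₁ :=
      Nat.div_pos (Nat.le_of_dvd hk hqk₁) (Nat.pos_of_dvd_of_pos hqk₁ hk)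
    rw [Nat.eq_of_mul_eq_mul_right (pow_pos hd0 s) hxy]
  · intro H hH
    rw [Finset.mem_Icc] at hH
    obtain ⟨d, hd, hmax⟩ := Finset.exists_max_image (k.divisors.filter fun d => d ^ s ∣ H) id
      ⟨1, by simp [hk.ne']⟩
    simp only [Finset.mem_filter, Nat.mem_divisors, id] at hd hmax
    obtain ⟨⟨⟨q, rfl⟩, -⟩, h, rfl⟩ := hd
    have hd0 : 0 < d := Nat.pos_of_mul_pos_right hk
    have hq0 : 0 < q := Nat.pos_of_mul_pos_left hk
    refine ⟨⟨q, h⟩, ?_, ?_⟩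
    · simp only [Finset.mem_sigma, Nat.mem_divisors, Finset.mem_filter, Finset.mem_Icc]
      refine ⟨⟨dvd_mul_left _ _, hk.ne'⟩, ⟨?_, ?_⟩, ?_⟩
      · exact Nat.pos_of_mul_pos_left hH.1
      · rw [mul_pow] at hH
        exact Nat.le_of_mul_le_mul_left hH.2 (pow_pos hd0 s)
      · rw [ggcd_pow_eq_one_iff hs hq0]
        intro e heh heq
        have he : d * e ≤ d := hmax _ ⟨⟨mul_dvd_mul_left d heq, hk.ne'⟩,
          by rw [mul_pow]; exact mul_dvd_mul_left _ heh⟩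
        have he0 : 0 < e := Nat.pos_of_dvd_of_pos heq hq0
        nlinarith
    · simp only [Nat.mul_div_cancel _ hq0, mul_comm]
  · rintro ⟨q, h⟩ hx
    simp only [Finset.mem_sigma, Nat.mem_divisors] at hx
    obtain ⟨⟨⟨d, rfl⟩, -⟩, -⟩ := hx
    have hq0 : 0 < q := Nat.pos_of_mul_pos_right hk
    have hd0 : 0 < d := Nat.pos_of_mul_pos_left hk
    rw [Nat.mul_div_cancel_left _ hq0]
    push_cast
    rw [mul_pow, mul_div_mul_right _ _ (by positivity)]

theorem sum_Icc_exp_mul_div {N : ℕ} (hN : N ≠ 0) (m : ℕ) :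
    ∑ h ∈ Finset.Icc 1 N, Complex.exp (2 * Real.pi * Complex.I * m * (h / N)) =
      if N ∣ m then (N : ℂ) else 0 := by
  have hprim := Complex.isPrimitiveRoot_exp N hN
  set ζ := Complex.exp (2 * Real.pi * Complex.I / N) with hζ
  have hterm (h : ℕ) :
      Complex.exp (2 * Real.pi * Complex.I * m * (h / N)) = (ζ ^ m) ^ h := by
    rw [hζ, ← Complex.exp_nat_mul, ← Complex.exp_nat_mul]
    congr 1
    ring
  simp_rw [hterm]
  split_ifs with hdvd
  · simp [(hprim.pow_eq_one_iff_dvd m).2 hdvd]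
  · have hne : ζ ^ m ≠ 1 := mt (hprim.pow_eq_one_iff_dvd m).1 hdvd
    have hpow : (ζ ^ m) ^ N = 1 := by rw [pow_right_comm, hprim.pow_eq_one, one_pow]
    rw [← Finset.Ico_add_one_right_eq_Icc, geom_sum_Ico hne (by omega), pow_succ, hpow]
    simp

/-- `∑_{q|k} c_q^{(s)}(n^s) = k^s` if `k ∣ n` and `= 0` otherwise. -/
theorem sum_cohenRamanujan_divisors (k n s : ℕ) (hk : 0 < k) (hn : 0 < n) (hs : 0 < s) :
    (k ∣ n → ∑ q ∈ k.divisors, cohenRamanujan s q (n ^ s) = ((k : ℂ)) ^ s) ∧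
    (¬ k ∣ n → ∑ q ∈ k.divisors, cohenRamanujan s q (n ^ s) = 0) := by
  have key : ∑ q ∈ k.divisors, cohenRamanujan s q (n ^ s) =
      if k ∣ n then (k : ℂ) ^ s else 0 := by
    have h₁ := sum_divisors_sum_ggcd_eq_one hk hs
      (fun x : ℚ => Complex.exp (2 * Real.pi * Complex.I * (n ^ s : ℕ) * x))
    have h₂ := sum_Icc_exp_mul_div (pow_pos hk s).ne' (n ^ s)
    simp only [Nat.pow_dvd_pow_iff hs.ne'] at h₂
    push_cast at h₁ h₂
    rw [← h₂, ← h₁]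
    simp only [cohenRamanujan, mul_div_assoc, Nat.cast_pow]
  rw [key]
  exact ⟨fun h => if_pos h, fun h => if_neg h⟩
end

section
/- Let k, s, and n be positive integers, let d be the largest positive integer such that d | k and d^s | n, and set N = k/d. Then the alternating sum S(k,n) = ∑_{e | k} μ(k/e) · 2^{ω(e^s / (e^s, n)_s)} · (e^s, n)_s satisfies: S(k,n) = J_s(k)/J_s(N) if N is squarefree, and S(k,n) = 0 if N is not squarefree. -/
open scoped BigOperators

/-- The Jordan totient function `J_s(n) = n^s ∏_{p ∣ n} (1 - 1/p^s)` (as a real number). -/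
noncomputable def jordanTotient (s n : ℕ) : ℝ :=
  (n : ℝ) ^ s * ∏ p ∈ n.primeFactors, (1 - 1 / (p : ℝ) ^ s)

/-- The base of the largest `s`-th power dividing `n`. -/
theorem exists_forall_pow_dvd_iff_dvd (s n : ℕ) (hs : 0 < s) (hn : 0 < n) :
    ∃ D : ℕ, 0 < D ∧ ∀ t : ℕ, t ^ s ∣ n ↔ t ∣ D := by
  have hle : ∀ t : ℕ, t ^ s ∣ n → t ≤ n := fun t ht =>
    (Nat.le_self_pow hs.ne' t).trans (Nat.le_of_dvd hn ht)
  have h_one : 1 ^ s ∣ n := by simp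
  set D := Nat.findGreatest (fun t => t ^ s ∣ n) n with hD
  have hDn : D ^ s ∣ n := Nat.findGreatest_spec (P := fun t => t ^ s ∣ n) (hle 1 h_one) h_one
  have hpos : 0 < D := Nat.le_findGreatest (hle 1 h_one) h_one
  refine ⟨D, hpos, fun t => ⟨fun ht => ?_, fun ht => (pow_dvd_pow_of_dvd ht s).trans hDn⟩⟩
  have hl : (Nat.lcm t D) ^ s ∣ n := by
    rw [← Nat.pow_lcm_pow]
    exact Nat.lcm_dvd ht hDn
  have hlD : Nat.lcm t D ≤ D := Nat.le_findGreatest (hle _ hl) hl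
  have heq : Nat.lcm t D = D := le_antisymm hlD
    (Nat.le_of_dvd (Nat.pos_of_ne_zero fun h => by
      rw [h, zero_pow hs.ne'] at hl
      exact hn.ne' (Nat.eq_zero_of_zero_dvd hl)) (Nat.dvd_lcm_right t D))
  exact heq ▸ Nat.dvd_lcm_left t D

theorem ggcd_pow_left_eq (s n D e : ℕ) (hs : 0 < s) (hD : 0 < D)
    (h : ∀ t : ℕ, t ^ s ∣ n ↔ t ∣ D) : ggcd s (e ^ s) n = Nat.gcd e D ^ s := by
  refine IsGreatest.csSup_eq ⟨⟨⟨_, rfl⟩, pow_dvd_pow_of_dvd (Nat.gcd_dvd_left e D) s,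
    (h _).2 (Nat.gcd_dvd_right e D)⟩, ?_⟩
  rintro _ ⟨⟨t, rfl⟩, hte, htn⟩
  exact Nat.pow_le_pow_left (Nat.le_of_dvd (Nat.gcd_pos_of_pos_right e hD)
    (Nat.dvd_gcd ((Nat.pow_dvd_pow_iff hs.ne').1 hte) ((h t).1 htn))) s

theorem jordanTotient_one (s : ℕ) : jordanTotient s 1 = 1 := by
  simp [jordanTotient]

theorem jordanTotient_mul (s : ℕ) {a b : ℕ} (h : a.Coprime b) :
    jordanTotient s (a * b) = jordanTotient s a * jordanTotient s b := by
  simp only [jordanTotient]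
  rw [h.primeFactors_mul, Finset.prod_union h.disjoint_primeFactors]
  push_cast
  ring

theorem jordanTotient_prime_pow (s : ℕ) {p i : ℕ} (hp : p.Prime) (hi : i ≠ 0) :
    jordanTotient s (p ^ i) = ((p : ℝ) ^ i) ^ s * (1 - 1 / (p : ℝ) ^ s) := by
  simp [jordanTotient, Nat.primeFactors_prime_pow hi hp]

theorem div_gcd_mul_of_coprime {D a b : ℕ} (h : a.Coprime b) :
    a * b / Nat.gcd (a * b) D = a / Nat.gcd a D * (b / Nat.gcd b D) := by
  rw [Nat.Coprime.mul_gcd h,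
    Nat.mul_div_mul_comm (Nat.gcd_dvd_left a D) (Nat.gcd_dvd_left b D)]

theorem coprime_div_gcd {D a b : ℕ} (h : a.Coprime b) :
    (a / Nat.gcd a D).Coprime (b / Nat.gcd b D) :=
  (h.coprime_dvd_left (Nat.div_dvd_of_dvd (Nat.gcd_dvd_left a D))).coprime_dvd_right
    (Nat.div_dvd_of_dvd (Nat.gcd_dvd_left b D))

/-- The function `e ↦ 2 ^ ω(e / (e, D)) * (e, D) ^ s`. -/
noncomputable def weightedGcdPow (s D : ℕ) : ArithmeticFunction ℝ where
  toFun e := if e = 0 then 0 else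
    (2 : ℝ) ^ (e / Nat.gcd e D).primeFactors.card * (Nat.gcd e D : ℝ) ^ s
  map_zero' := by simp

theorem weightedGcdPow_apply (s D : ℕ) {e : ℕ} (he : e ≠ 0) :
    weightedGcdPow s D e =
      (2 : ℝ) ^ (e / Nat.gcd e D).primeFactors.card * (Nat.gcd e D : ℝ) ^ s :=
  if_neg he

theorem isMultiplicative_weightedGcdPow (s D : ℕ) : (weightedGcdPow s D).IsMultiplicative := by
  refine ArithmeticFunction.IsMultiplicative.iff_ne_zero.2
    ⟨by simp [weightedGcdPow_apply], fun {a b} ha hb h => ?_⟩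
  rw [weightedGcdPow_apply s D (mul_ne_zero ha hb), weightedGcdPow_apply s D ha,
    weightedGcdPow_apply s D hb, div_gcd_mul_of_coprime h, (coprime_div_gcd h).primeFactors_mul,
    Finset.card_union_of_disjoint (coprime_div_gcd h).disjoint_primeFactors,
    Nat.Coprime.mul_gcd h, pow_add]
  push_cast
  ring

/-- The function sending `k` to `J_s(k) / J_s(k / (k, D))` if `k / (k, D)` is squarefree and
to `0` otherwise. -/
noncomputable def jordanQuotient (s D : ℕ) : ArithmeticFunction ℝ where
  toFun k := if k = 0 then 0 else if Squarefree (k / Nat.gcd k D) then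
    jordanTotient s k / jordanTotient s (k / Nat.gcd k D) else 0
  map_zero' := by simp

theorem jordanQuotient_apply (s D : ℕ) {k : ℕ} (hk : k ≠ 0) :
    jordanQuotient s D k = if Squarefree (k / Nat.gcd k D) then
      jordanTotient s k / jordanTotient s (k / Nat.gcd k D) else 0 :=
  if_neg hk

theorem isMultiplicative_jordanQuotient (s D : ℕ) : (jordanQuotient s D).IsMultiplicative := by
  refine ArithmeticFunction.IsMultiplicative.iff_ne_zero.2
    ⟨by simp [jordanQuotient_apply, jordanTotient_one], fun {a b} ha hb h => ?_⟩
  rw [jordanQuotient_apply s D (mul_ne_zero ha hb), jordanQuotient_apply s D ha,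
    jordanQuotient_apply s D hb, div_gcd_mul_of_coprime h, jordanTotient_mul s h,
    jordanTotient_mul s (coprime_div_gcd h)]
  simp only [Nat.squarefree_mul (coprime_div_gcd h), mul_div_mul_comm]
  split_ifs <;> first | tauto | simp

theorem moebius_mul_apply (f : ArithmeticFunction ℝ) (k : ℕ) :
    ((ArithmeticFunction.moebius : ArithmeticFunction ℝ) * f) k =
      ∑ e ∈ k.divisors, ((ArithmeticFunction.moebius (k / e) : ℤ) : ℝ) * f e := by
  rw [ArithmeticFunction.mul_apply, Nat.sum_divisorsAntidiagonal'
    (fun x y => (ArithmeticFunction.moebius : ArithmeticFunction ℝ) x * f y)]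
  simp

theorem moebius_mul_apply_prime_pow_succ (f : ArithmeticFunction ℝ) {p : ℕ} (hp : p.Prime)
    (a : ℕ) : ((ArithmeticFunction.moebius : ArithmeticFunction ℝ) * f) (p ^ (a + 1)) =
      f (p ^ (a + 1)) - f (p ^ a) := by
  rw [moebius_mul_apply, Nat.sum_divisors_prime_pow hp, Finset.sum_range_succ,
    Finset.sum_range_succ, Finset.sum_eq_zero]
  · rw [Nat.div_self (pow_pos hp.pos _), Nat.pow_div a.le_succ hp.pos]
    simp [ArithmeticFunction.moebius_apply_prime hp]
    ring
  · intro i hi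
    rw [Finset.mem_range] at hi
    rw [Nat.pow_div (by omega) hp.pos,
      ArithmeticFunction.moebius_apply_prime_pow hp (by omega), if_neg (by omega)]
    simp

theorem moebius_mul_weightedGcdPow (s D : ℕ) (hs : 0 < s) :
    (ArithmeticFunction.moebius : ArithmeticFunction ℝ) * weightedGcdPow s D =
      jordanQuotient s D := by
  have hmul := ArithmeticFunction.isMultiplicative_moebius.intCast (R := ℝ) |>.mul
    (isMultiplicative_weightedGcdPow s D)
  refine (ArithmeticFunction.IsMultiplicative.eq_iff_eq_on_prime_powers _ hmul _
    (isMultiplicative_jordanQuotient s D)).2 fun p i hp => ?_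
  rcases i with _ | a
  · rw [pow_zero, hmul.1, (isMultiplicative_jordanQuotient s D).1]
  have hp0 : (p : ℝ) ≠ 0 := by exact_mod_cast hp.ne_zero
  have hfac : (1 - 1 / (p : ℝ) ^ s) ≠ 0 := by
    have h_one : (1 : ℝ) < (p : ℝ) ^ s := one_lt_pow₀ (by exact_mod_cast hp.one_lt) hs.ne'
    rw [sub_ne_zero, ne_comm]
    exact (by rw [div_lt_one (by linarith)]; exact h_one : 1 / (p : ℝ) ^ s < 1).ne
  obtain ⟨j, hj, hg⟩ := (Nat.dvd_prime_pow hp).1 (Nat.gcd_dvd_left (p ^ (a + 1)) D)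
  have hg' : Nat.gcd (p ^ a) D = p ^ min a j := by
    have : Nat.gcd (p ^ a) (Nat.gcd (p ^ (a + 1)) D) = Nat.gcd (p ^ a) D := by
      rw [← Nat.gcd_assoc, Nat.gcd_eq_left (pow_dvd_pow p a.le_succ)]
    rw [← this, hg]
    rcases le_total a j with h | h
    · rw [min_eq_left h, Nat.gcd_eq_left (pow_dvd_pow p h)]
    · rw [min_eq_right h, Nat.gcd_eq_right (pow_dvd_pow p h)]
  rw [moebius_mul_apply_prime_pow_succ _ hp, weightedGcdPow_apply s D (pow_ne_zero _ hp.ne_zero),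
    weightedGcdPow_apply s D (pow_ne_zero _ hp.ne_zero),
    jordanQuotient_apply s D (pow_ne_zero _ hp.ne_zero), hg, hg', Nat.pow_div hj hp.pos,
    Nat.pow_div (min_le_left _ _) hp.pos, jordanTotient_prime_pow s hp a.succ_ne_zero]
  obtain rfl | rfl | hlt : j = a + 1 ∨ j = a ∨ j < a := by omega
  · rw [min_eq_left a.le_succ]
    simp [jordanTotient_one]
    field_simp
    ring
  · rw [Nat.add_sub_cancel_left, min_self, Nat.sub_self, if_pos (by simpa using hp.squarefree),
      jordanTotient_prime_pow s hp one_ne_zero, Nat.primeFactors_prime_pow one_ne_zero hp,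
      mul_div_mul_right _ _ hfac]
    simp
    field_simp
    ring
  · have hsq : ¬ Squarefree (p ^ (a + 1 - j)) := by
      rw [Nat.squarefree_pow_iff hp.ne_one (by omega)]
      omega
    rw [if_neg hsq, min_eq_right hlt.le, Nat.primeFactors_prime_pow (by omega) hp,
      Nat.primeFactors_prime_pow (by omega) hp, sub_self]

/-- with `d` the largest positive integer such that `d ∣ k` and `d^s ∣ n`,
and `N = k/d`, the sum `S(k,n) = ∑_{e|k} μ(k/e)·2^{ω(e^s/(e^s,n)_s)}·(e^s,n)_s`
equals `J_s(k)/J_s(N)` if `N` is squarefree and `0` otherwise. -/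
theorem alternating_sum_eval (k s n : ℕ) (hk : 0 < k) (hs : 0 < s) (hn : 0 < n)
    (d : ℕ) (hd : 0 < d) (hdk : d ∣ k) (hdn : d ^ s ∣ n)
    (hdmax : ∀ e : ℕ, 0 < e → e ∣ k → e ^ s ∣ n → e ≤ d)
    (N : ℕ) (hN : N = k / d) :
    (Squarefree N →
      ∑ e ∈ k.divisors, ((ArithmeticFunction.moebius (k / e) : ℤ) : ℝ) *
          ((2 : ℝ) ^ (e ^ s / ggcd s (e ^ s) n).primeFactors.card * (ggcd s (e ^ s) n : ℝ)) =
        jordanTotient s k / jordanTotient s N) ∧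
    (¬ Squarefree N →
      ∑ e ∈ k.divisors, ((ArithmeticFunction.moebius (k / e) : ℤ) : ℝ) *
          ((2 : ℝ) ^ (e ^ s / ggcd s (e ^ s) n).primeFactors.card * (ggcd s (e ^ s) n : ℝ)) = 0) := by
  obtain ⟨D, hD, hDiff⟩ := exists_forall_pow_dvd_iff_dvd s n hs hn
  have hdD : d = Nat.gcd k D := by
    have hdvd : d ∣ Nat.gcd k D := Nat.dvd_gcd hdk ((hDiff d).1 hdn)
    exact le_antisymm (Nat.le_of_dvd (Nat.gcd_pos_of_pos_left D hk) hdvd)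
      (hdmax _ (Nat.gcd_pos_of_pos_left D hk) (Nat.gcd_dvd_left k D)
        ((hDiff _).2 (Nat.gcd_dvd_right k D)))
  have hsum : ∑ e ∈ k.divisors, ((ArithmeticFunction.moebius (k / e) : ℤ) : ℝ) *
      ((2 : ℝ) ^ (e ^ s / ggcd s (e ^ s) n).primeFactors.card * (ggcd s (e ^ s) n : ℝ)) =
      jordanQuotient s D k := by
    rw [← moebius_mul_weightedGcdPow s D hs, moebius_mul_apply]
    refine Finset.sum_congr rfl fun e he => ?_
    rw [ggcd_pow_left_eq s n D e hs hD hDiff,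
      weightedGcdPow_apply s D (Nat.pos_of_mem_divisors he).ne',
      ← Nat.div_pow (Nat.gcd_dvd_left e D), Nat.primeFactors_pow _ hs.ne', Nat.cast_pow]
  rw [hsum, jordanQuotient_apply s D hk.ne', ← hdD, ← hN]
  exact ⟨fun h => if_pos h, fun h => if_neg h⟩
end

section
/- For all positive integers k, s, and n, the inequality 2^{ω(k^s / (k^s, n)_s)} · (k^s, n)_s ≥ 2^{ω(k)} holds. -/
open scoped BigOperators

theorem Nat.two_pow_card_primeFactors_le {m : ℕ} (hm : m ≠ 0) :
    2 ^ m.primeFactors.card ≤ m :=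
  calc 2 ^ m.primeFactors.card ≤ ∏ p ∈ m.primeFactors, p :=
        Finset.pow_card_le_prod _ _ _ fun _ hp => (Nat.prime_of_mem_primeFactors hp).two_le
    _ ≤ m := Nat.le_of_dvd (Nat.pos_of_ne_zero hm) (Nat.prod_primeFactors_dvd m)

theorem ggcd_dvd_left (s : ℕ) {a : ℕ} (ha : 0 < a) (b : ℕ) : ggcd s a b ∣ a := by
  have hmem : ggcd s a b ∈ {m : ℕ | (∃ d : ℕ, m = d ^ s) ∧ m ∣ a ∧ m ∣ b} :=
    Nat.sSup_mem ⟨1, ⟨1, (one_pow s).symm⟩, one_dvd a, one_dvd b⟩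
      ⟨a, fun _ hm => Nat.le_of_dvd ha hm.2.1⟩
  exact hmem.2.1

/-- `2^{ω(k^s/(k^s,n)_s)} · (k^s,n)_s ≥ 2^{ω(k)}`. -/
theorem grytczuk_rhs_ge (k s n : ℕ) (hk : 0 < k) (hs : 0 < s) (hn : 0 < n) :
    2 ^ k.primeFactors.card ≤
      2 ^ (k ^ s / ggcd s (k ^ s) n).primeFactors.card * ggcd s (k ^ s) n := by
  have hks : 0 < k ^ s := pow_pos hk s
  obtain ⟨c, hc⟩ := ggcd_dvd_left s hks n
  set g := ggcd s (k ^ s) n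
  obtain ⟨hg, hc0⟩ : g ≠ 0 ∧ c ≠ 0 := mul_ne_zero_iff.mp (hc ▸ hks.ne')
  have hdiv : k ^ s / g = c := by
    rw [hc, Nat.mul_div_cancel_left c (Nat.pos_of_ne_zero hg)]
  have hcard : k.primeFactors.card ≤ c.primeFactors.card + g.primeFactors.card := by
    rw [← Nat.primeFactors_pow k hs.ne', hc, Nat.primeFactors_mul hg hc0, Finset.union_comm]
    exact Finset.card_union_le _ _
  rw [hdiv]
  calc 2 ^ k.primeFactors.card ≤ 2 ^ (c.primeFactors.card + g.primeFactors.card) :=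
        Nat.pow_le_pow_right two_pos hcard
    _ = 2 ^ c.primeFactors.card * 2 ^ g.primeFactors.card := pow_add _ _ _
    _ ≤ 2 ^ c.primeFactors.card * g :=
        Nat.mul_le_mul_left _ (Nat.two_pow_card_primeFactors_le hg)
end
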